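/- arXiv:2502.16070 — 2 statements merged into one kernel-verified Lean document; each statement's English description precedes it below -/
import Mathlib

section
/- Let D be a matrix differential operator of size N with coefficients F_0, …, F_m ∈ Mat_N(ℂ[x]) satisfying deg F_i ≤ i, and write F_i(x) = Σ_{j=0}^i x^j F_j^i with F_j^i ∈ Mat_N(ℂ). If P ∈ Mat_N(ℂ[x]) is monic of degree n (coefficient of x^n equal to the identity) and P·D = Λ·P for some constant matrix Λ ∈ Mat_N(ℂ), then Λ = Σ_{i=0}^m [n]_i F_i^i, where [n]_i = n(n−1)⋯(n−i+1) and [n]_0 = 1. -/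
open Polynomial

/-- Matrix polynomials of size `N` with complex coefficients. -/
abbrev MatPoly (N : ℕ) := Matrix (Fin N) (Fin N) (Polynomial ℂ)

/-- Entrywise derivative of a matrix polynomial. -/
noncomputable def matDeriv {N : ℕ} (P : MatPoly N) : MatPoly N :=
  Matrix.of fun i j => derivative (P i j)

/-- The right action of the differential operator `D = ∑_{j=0}^m ∂^j F_j` on a matrix
polynomial: `P·D = ∑_{j=0}^m P^{(j)} F_j`. -/
noncomputable def opApply {N : ℕ} (m : ℕ) (F : ℕ → MatPoly N) (P : MatPoly N) : MatPoly N :=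
  ∑ j ∈ Finset.range (m + 1), matDeriv^[j] P * F j

/-- A constant matrix viewed as a matrix polynomial. -/
noncomputable def cm {N : ℕ} (M : Matrix (Fin N) (Fin N) ℂ) : MatPoly N := M.map Polynomial.C

/-- The coefficient of `x^k` of a matrix polynomial. -/
def mcoeff {N : ℕ} (P : MatPoly N) (k : ℕ) : Matrix (Fin N) (Fin N) ℂ :=
  Matrix.of fun i j => (P i j).coeff k

/-- `P` is monic of degree `n`: all entries have degree at most `n` and the
coefficient of `x^n` is the identity matrix. -/
def IsMonicDeg {N : ℕ} (P : MatPoly N) (n : ℕ) : Prop :=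
  (∀ i j, (P i j).degree ≤ (n : WithBot ℕ)) ∧ mcoeff P n = 1

theorem matDeriv_iterate_apply {N : ℕ} (P : MatPoly N) (k : ℕ) (a b : Fin N) :
    (matDeriv^[k] P) a b = derivative^[k] (P a b) := by
  induction k with
  | zero => rfl
  | succ k ih =>
    rw [Function.iterate_succ_apply', Function.iterate_succ_apply', ← ih]
    rfl

theorem coeff_iterate_derivative_mul_of_natDegree_le {R : Type*} [CommSemiring R] {p q : R[X]}
    {n k : ℕ} (hp : p.natDegree ≤ n) (hq : q.natDegree ≤ k) :
    (derivative^[k] p * q).coeff n = (n.descFactorial k : R) * (p.coeff n * q.coeff k) := by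
  rcases le_or_gt k n with hk | hk
  · have hd : (derivative^[k] p).natDegree ≤ n - k :=
      (natDegree_iterate_derivative p k).trans (Nat.sub_le_sub_right hp k)
    have hc := coeff_mul_add_eq_of_natDegree_le hd hq
    rw [coeff_iterate_derivative, Nat.sub_add_cancel hk] at hc
    rw [hc, nsmul_eq_mul, mul_assoc]
  · rw [iterate_derivative_eq_zero (hp.trans_lt hk), Nat.descFactorial_of_lt hk]
    simp

theorem mcoeff_iterate_matDeriv_mul {N : ℕ} {P Q : MatPoly N} {n k : ℕ}
    (hP : ∀ a b, (P a b).degree ≤ (n : WithBot ℕ))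
    (hQ : ∀ a b, (Q a b).degree ≤ (k : WithBot ℕ)) :
    mcoeff (matDeriv^[k] P * Q) n =
      (n.descFactorial k : ℂ) • (mcoeff P n * mcoeff Q k) := by
  ext a b
  simp only [mcoeff, Matrix.of_apply, Matrix.mul_apply, Matrix.smul_apply, finsetSum_coeff,
    smul_eq_mul, Finset.mul_sum, matDeriv_iterate_apply]
  exact Finset.sum_congr rfl fun c _ => coeff_iterate_derivative_mul_of_natDegree_le
    (natDegree_le_of_degree_le (hP a c)) (natDegree_le_of_degree_le (hQ c b))

theorem mcoeff_sum {N : ℕ} {ι : Type*} (s : Finset ι) (f : ι → MatPoly N) (n : ℕ) :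
    mcoeff (∑ i ∈ s, f i) n = ∑ i ∈ s, mcoeff (f i) n := by
  ext a b
  simp [mcoeff, Matrix.sum_apply]

theorem mcoeff_cm_mul {N : ℕ} (M : Matrix (Fin N) (Fin N) ℂ) (P : MatPoly N) (n : ℕ) :
    mcoeff (cm M * P) n = M * mcoeff P n := by
  ext a b
  simp [mcoeff, cm, Matrix.mul_apply]

/-- If `P` is monic of degree `n`, `D = ∑ ∂^i F_i` has `deg F_i ≤ i`, and `P·D = Λ·P`
for a constant matrix `Λ`, then `Λ = ∑_{i=0}^m [n]_i F_i^i`. -/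
theorem eigenvalue_of_monic {N : ℕ} (m n : ℕ) (F : ℕ → MatPoly N)
    (hdeg : ∀ i, i ≤ m → ∀ a b, ((F i) a b).degree ≤ (i : WithBot ℕ))
    (P : MatPoly N) (hP : IsMonicDeg P n)
    (Λ : Matrix (Fin N) (Fin N) ℂ)
    (h : opApply m F P = cm Λ * P) :
    Λ = ∑ i ∈ Finset.range (m + 1), (n.descFactorial i : ℂ) • mcoeff (F i) i := by
  have hn := congrArg (fun Q => mcoeff Q n) h
  simp only [opApply, mcoeff_sum, mcoeff_cm_mul, hP.2, mul_one] at hn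
  rw [← hn]
  refine Finset.sum_congr rfl fun i hi => ?_
  rw [mcoeff_iterate_matDeriv_mul hP.1 (hdeg i (Nat.lt_succ_iff.mp (Finset.mem_range.mp hi))),
    hP.2, one_mul]
end

section
/- Let (P_n)_{n≥0} and (P̃_n)_{n≥0} be sequences in Mat_N(ℂ[x]) with P_n and P̃_n monic of degree n for every n. Let 𝔇 be the set of matrix differential operators B of size N for which there exist constant matrices Λ_n(B) with P_n·B = Λ_n(B)·P_n for all n, and let 𝔇̃ be defined analogously using (P̃_n). Suppose 𝒱 and 𝒩 are matrix differential operators and A_n, Ã_n are invertible constant matrices with P_n·𝒱 = A_n·P̃_n and P̃_n·𝒩 = Ã_n·P_n for all n, and suppose the composite D = 𝒱𝒩 commutes with every element of 𝔇, i.e. P·(DB) = P·(BD) for all P ∈ Mat_N(ℂ[x]) and all B ∈ 𝔇. Then for every Z ∈ 𝔇 that commutes with every element of 𝔇, the composite 𝒩Z𝒱 belongs to 𝔇̃ and commutes with every element of 𝔇̃; in particular the composite 𝒩𝒱 commutes with every element of 𝔇̃. -/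
open Polynomial

/-- `T` is (the right action of) a matrix differential operator with polynomial
coefficients. -/
def IsMatDiffOp {N : ℕ} (T : MatPoly N → MatPoly N) : Prop :=
  ∃ (m : ℕ) (F : ℕ → MatPoly N), ∀ P, T P = opApply m F P

/-- The algebra `𝔇` of differential operators having each `P_n` as an eigenfunction
with a constant (matrix) eigenvalue. -/
def algD {N : ℕ} (P : ℕ → MatPoly N) : Set (MatPoly N → MatPoly N) :=
  {T | IsMatDiffOp T ∧ ∃ Λ : ℕ → Matrix (Fin N) (Fin N) ℂ, ∀ n, T (P n) = cm (Λ n) * P n}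

theorem cm_mul {N : ℕ} (A B : Matrix (Fin N) (Fin N) ℂ) : cm (A * B) = cm A * cm B :=
  Matrix.map_mul

theorem matDeriv_add {N : ℕ} (P Q : MatPoly N) :
    matDeriv (P + Q) = matDeriv P + matDeriv Q := by
  ext1 i j
  simp [matDeriv]

theorem matDeriv_mul {N : ℕ} (P Q : MatPoly N) :
    matDeriv (P * Q) = matDeriv P * Q + P * matDeriv Q := by
  ext1 i j
  simp [matDeriv, Matrix.mul_apply, Finset.sum_add_distrib]

theorem matDeriv_cm {N : ℕ} (M : Matrix (Fin N) (Fin N) ℂ) : matDeriv (cm M) = 0 := by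
  ext1 i j
  simp [matDeriv, cm]

theorem matDeriv_cm_mul {N : ℕ} (M : Matrix (Fin N) (Fin N) ℂ) (P : MatPoly N) :
    matDeriv (cm M * P) = cm M * matDeriv P := by
  rw [matDeriv_mul, matDeriv_cm, zero_mul, zero_add]

theorem matDeriv_iterate_add {N : ℕ} (k : ℕ) (P Q : MatPoly N) :
    matDeriv^[k] (P + Q) = matDeriv^[k] P + matDeriv^[k] Q := by
  induction k with
  | zero => rfl
  | succ k ih => simp only [Function.iterate_succ_apply', ih, matDeriv_add]

theorem matDeriv_iterate_cm_mul {N : ℕ} (k : ℕ) (M : Matrix (Fin N) (Fin N) ℂ) (P : MatPoly N) :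
    matDeriv^[k] (cm M * P) = cm M * matDeriv^[k] P := by
  induction k with
  | zero => rfl
  | succ k ih => simp only [Function.iterate_succ_apply', ih, matDeriv_cm_mul]

namespace IsMatDiffOp

variable {N : ℕ} {S T : MatPoly N → MatPoly N}

theorem map_add (hT : IsMatDiffOp T) (P Q : MatPoly N) : T (P + Q) = T P + T Q := by
  obtain ⟨m, F, h⟩ := hT
  simp only [h, opApply, matDeriv_iterate_add, add_mul, Finset.sum_add_distrib]

theorem map_cm_mul (hT : IsMatDiffOp T) (M : Matrix (Fin N) (Fin N) ℂ) (P : MatPoly N) :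
    T (cm M * P) = cm M * T P := by
  obtain ⟨m, F, h⟩ := hT
  simp only [h, opApply, matDeriv_iterate_cm_mul, Finset.mul_sum, mul_assoc]

/-- The order bound of a differential operator may be enlarged. -/
theorem exists_order_le (hT : IsMatDiffOp T) :
    ∃ m, ∀ m', m ≤ m' → ∃ F : ℕ → MatPoly N, ∀ P, T P = opApply m' F P := by
  obtain ⟨m, F, h⟩ := hT
  refine ⟨m, fun m' hm => ⟨fun j => if j < m + 1 then F j else 0, fun P => ?_⟩⟩
  rw [h, opApply, opApply]
  refine Finset.sum_subset_zero_on_sdiff (Finset.range_mono (by lia)) ?_ ?_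
  · intro j hj
    have : ¬ j < m + 1 := by simpa using (Finset.mem_sdiff.1 hj).2
    simp [this]
  · intro j hj
    simp [Finset.mem_range.1 hj]

theorem add (hS : IsMatDiffOp S) (hT : IsMatDiffOp T) : IsMatDiffOp fun P => S P + T P := by
  obtain ⟨m, hS⟩ := hS.exists_order_le
  obtain ⟨n, hT⟩ := hT.exists_order_le
  obtain ⟨F, hF⟩ := hS (max m n) (le_max_left _ _)
  obtain ⟨G, hG⟩ := hT (max m n) (le_max_right _ _)
  refine ⟨max m n, fun j => F j + G j, fun P => ?_⟩
  simp only [hF, hG, opApply, mul_add, Finset.sum_add_distrib]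

theorem zero : IsMatDiffOp fun _ : MatPoly N => (0 : MatPoly N) :=
  ⟨0, fun _ => 0, fun P => by simp [opApply]⟩

theorem sum {ι : Type*} (s : Finset ι) {T : ι → MatPoly N → MatPoly N}
    (hT : ∀ i ∈ s, IsMatDiffOp (T i)) : IsMatDiffOp fun P => ∑ i ∈ s, T i P := by
  classical
  induction s using Finset.induction_on with
  | empty => simpa using zero
  | insert a s ha ih =>
    simp only [Finset.sum_insert ha]
    exact (hT a (by simp)).add (ih fun i hi => hT i (by simp [hi]))

theorem mul_right (hT : IsMatDiffOp T) (G : MatPoly N) : IsMatDiffOp fun P => T P * G := by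
  obtain ⟨m, F, h⟩ := hT
  exact ⟨m, fun j => F j * G, fun P => by simp only [h, opApply, Finset.sum_mul, mul_assoc]⟩

theorem iterate_matDeriv (k : ℕ) : IsMatDiffOp (matDeriv (N := N))^[k] :=
  ⟨k, fun j => if j = k then 1 else 0, fun P => by simp [opApply]⟩

theorem matDeriv_comp (hT : IsMatDiffOp T) : IsMatDiffOp fun P => matDeriv (T P) := by
  obtain ⟨m, F, h⟩ := hT
  have key : (fun P => matDeriv (T P)) = fun P => ∑ j ∈ Finset.range (m + 1),
      (matDeriv^[j + 1] P * F j + matDeriv^[j] P * matDeriv (F j)) := by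
    funext P
    rw [h, opApply]
    refine (map_sum (AddMonoidHom.mk' matDeriv matDeriv_add) _ _).trans
      (Finset.sum_congr rfl fun j _ => ?_)
    rw [AddMonoidHom.mk'_apply, matDeriv_mul, Function.iterate_succ_apply']
  rw [key]
  exact sum _ fun j _ =>
    ((iterate_matDeriv (j + 1)).mul_right _).add ((iterate_matDeriv j).mul_right _)

theorem comp (hS : IsMatDiffOp S) (hT : IsMatDiffOp T) : IsMatDiffOp fun P => S (T P) := by
  obtain ⟨m, F, h⟩ := hS
  simp only [h, opApply]
  refine sum _ fun j hj => mul_right ?_ _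
  clear hj
  induction j with
  | zero => exact hT
  | succ j ih =>
    simp only [Function.iterate_succ_apply']
    exact ih.matDeriv_comp

end IsMatDiffOp

/-- A monic sequence generates the matrix polynomials as a left module over constant matrices. -/
theorem IsMonicDeg.induction_on {N : ℕ} {P : ℕ → MatPoly N} (hP : ∀ n, IsMonicDeg (P n) n)
    {p : MatPoly N → Prop} (zero : p 0)
    (add_cm_mul : ∀ Q M n, p Q → p (Q + cm M * P n)) (Q : MatPoly N) : p Q := by
  have key : ∀ n : ℕ, ∀ Q : MatPoly N, (∀ i j, (Q i j).degree < (n : WithBot ℕ)) → p Q := by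
    intro n
    induction n with
    | zero =>
      intro Q hQ
      have : Q = 0 := by
        ext1 i j
        exact degree_eq_bot.1 (Nat.WithBot.lt_zero_iff.1 (hQ i j))
      rwa [this]
    | succ n ih =>
      intro Q hQ
      rw [← sub_add_cancel Q (cm (mcoeff Q n) * P n)]
      refine add_cm_mul _ _ _ (ih _ fun i j => ?_)
      rw [degree_lt_iff_coeff_zero]
      intro k hk
      have hco : ((cm (mcoeff Q n) * P n) i j).coeff k = (mcoeff Q n * mcoeff (P n) k) i j := by
        simp [cm, Matrix.mul_apply, mcoeff, coeff_C_mul]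
      rw [Matrix.sub_apply, coeff_sub, hco]
      rcases hk.eq_or_lt with rfl | hk
      · rw [(hP n).2, mul_one]
        exact sub_self _
      · have h0 : mcoeff (P n) k = 0 := by
          ext a b
          exact coeff_eq_zero_of_degree_lt
            (((hP n).1 a b).trans_lt (by exact_mod_cast hk))
        rw [h0, mul_zero, Matrix.zero_apply, sub_zero]
        exact coeff_eq_zero_of_degree_lt ((hQ i j).trans_le (by exact_mod_cast hk))
  refine key ((∑ i, ∑ j, (Q i j).natDegree) + 1) Q fun i j => ?_
  have h : (Q i j).natDegree ≤ ∑ i, ∑ j, (Q i j).natDegree :=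
    (Finset.single_le_sum (f := fun j => (Q i j).natDegree) (fun _ _ => Nat.zero_le _)
      (Finset.mem_univ j)).trans
    (Finset.single_le_sum (f := fun i => ∑ j, (Q i j).natDegree) (fun _ _ => Nat.zero_le _)
      (Finset.mem_univ i))
  exact degree_le_natDegree.trans_lt (by exact_mod_cast Nat.lt_succ_of_le h)

/-- A differential operator is determined by its values on a monic sequence. -/
theorem IsMatDiffOp.ext_of_monic {N : ℕ} {P : ℕ → MatPoly N} (hP : ∀ n, IsMonicDeg (P n) n)
    {S T : MatPoly N → MatPoly N} (hS : IsMatDiffOp S) (hT : IsMatDiffOp T)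
    (h : ∀ n, S (P n) = T (P n)) (Q : MatPoly N) : S Q = T Q := by
  induction Q using IsMonicDeg.induction_on hP with
  | zero =>
    have hz : ∀ {R : MatPoly N → MatPoly N}, IsMatDiffOp R → R 0 = 0 := fun hR => by
      simpa using hR.map_add 0 0
    rw [hz hS, hz hT]
  | add_cm_mul Q M n ih =>
    rw [hS.map_add, hT.map_add, hS.map_cm_mul, hT.map_cm_mul, h, ih]

/-- Monic matrix polynomials are left-regular over constant matrices. -/
theorem IsMonicDeg.cm_mul_cancel {N n : ℕ} {P : MatPoly N} (hP : IsMonicDeg P n)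
    {A B : Matrix (Fin N) (Fin N) ℂ} (h : cm A * P = cm B * P) : A = B := by
  have hco : ∀ M : Matrix (Fin N) (Fin N) ℂ, mcoeff (cm M * P) n = M := fun M => by
    have : mcoeff (cm M * P) n = M * mcoeff P n := by
      ext i j
      simp [cm, Matrix.mul_apply, mcoeff, coeff_C_mul]
    rw [this, hP.2, mul_one]
  rw [← hco A, h, hco B]

/-- Operators commute if and only if their eigenvalue sequences do. -/
theorem commute_iff_eigenvalues {N : ℕ} {P : ℕ → MatPoly N} (hP : ∀ n, IsMonicDeg (P n) n)
    {S T : MatPoly N → MatPoly N} (hS : IsMatDiffOp S) (hT : IsMatDiffOp T)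
    {s t : ℕ → Matrix (Fin N) (Fin N) ℂ} (hs : ∀ n, S (P n) = cm (s n) * P n)
    (ht : ∀ n, T (P n) = cm (t n) * P n) :
    (∀ Q, S (T Q) = T (S Q)) ↔ ∀ n, s n * t n = t n * s n := by
  have hST : ∀ n, S (T (P n)) = cm (t n * s n) * P n := fun n => by
    rw [ht, hS.map_cm_mul, hs, cm_mul, mul_assoc]
  have hTS : ∀ n, T (S (P n)) = cm (s n * t n) * P n := fun n => by
    rw [hs, hT.map_cm_mul, ht, cm_mul, mul_assoc]
  constructor
  · intro h n
    refine (hP n).cm_mul_cancel ?_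
    rw [← hST, ← hTS, h]
  · intro h
    exact (hS.comp hT).ext_of_monic hP (hT.comp hS) fun n => by rw [hST, hTS, h]

/-- Conjugating by intertwiners turns eigenvalues `c` into `a * c * b`. -/
theorem darboux_eigenvalue {N : ℕ} {V W B : MatPoly N → MatPoly N}
    {p q : MatPoly N} {a b c : Matrix (Fin N) (Fin N) ℂ} (hW : IsMatDiffOp W)
    (hB : IsMatDiffOp B) (hVp : V p = cm a * q) (hWq : W q = cm b * p)
    (hBq : B q = cm c * q) : W (B (V p)) = cm (a * c * b) * p := by
  rw [hVp, hB.map_cm_mul, hBq, hW.map_cm_mul, hW.map_cm_mul, hWq]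
  simp only [cm_mul, mul_assoc]

/-- **Centers under Darboux transformations.** If `P_n·𝒱 = A_n·P̃_n` and
`P̃_n·𝒩 = Ã_n·P_n` with `A_n, Ã_n` invertible, and `D = 𝒱𝒩` commutes with every
element of `𝔇`, then for every central `Z ∈ 𝔇` the composite `𝒩Z𝒱` belongs to `𝔇̃`
and is central there; in particular `𝒩𝒱` commutes with every element of `𝔇̃`. -/
theorem center_darboux {N : ℕ} (P Pt : ℕ → MatPoly N)
    (hP : ∀ n, IsMonicDeg (P n) n) (hPt : ∀ n, IsMonicDeg (Pt n) n)
    (V Nop : MatPoly N → MatPoly N) (hV : IsMatDiffOp V) (hN : IsMatDiffOp Nop)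
    (An Atn : ℕ → Matrix (Fin N) (Fin N) ℂ)
    (hAn : ∀ n, IsUnit (An n)) (hAtn : ∀ n, IsUnit (Atn n))
    (h1 : ∀ n, V (P n) = cm (An n) * Pt n)
    (h2 : ∀ n, Nop (Pt n) = cm (Atn n) * P n)
    (hcen : ∀ B ∈ algD P, ∀ Q, B (Nop (V Q)) = Nop (V (B Q))) :
    (∀ Z ∈ algD P, (∀ B ∈ algD P, ∀ Q, B (Z Q) = Z (B Q)) →
      ((fun Q => V (Z (Nop Q))) ∈ algD Pt ∧
        ∀ B ∈ algD Pt, ∀ Q, B (V (Z (Nop Q))) = V (Z (Nop (B Q))))) ∧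
    (∀ B ∈ algD Pt, ∀ Q, B (V (Nop Q)) = V (Nop (B Q))) := by
  have hDP : ∀ n, Nop (V (P n)) = cm (An n * Atn n) * P n := fun n => by
    rw [h1, hN.map_cm_mul, h2, cm_mul, mul_assoc]
  have hDPt : ∀ n, V (Nop (Pt n)) = cm (Atn n * An n) * Pt n := fun n => by
    rw [h2, hV.map_cm_mul, h1, cm_mul, mul_assoc]
  have hmem : ∀ B ∈ algD Pt, (fun Q => Nop (B (V Q))) ∈ algD P := by
    rintro B ⟨hB, β, hβ⟩
    exact ⟨hN.comp (hB.comp hV), _, fun n => darboux_eigenvalue hN hB (h1 n) (h2 n) (hβ n)⟩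
  have hcomm : ∀ B ∈ algD Pt, ∀ β : ℕ → Matrix (Fin N) (Fin N) ℂ,
      (∀ n, B (Pt n) = cm (β n) * Pt n) →
      ∀ n, β n * (Atn n * An n) = Atn n * An n * β n := by
    intro B hB β hβ n
    have h := (commute_iff_eigenvalues hP (hmem B hB).1 (hN.comp hV)
      (fun n => darboux_eigenvalue hN hB.1 (h1 n) (h2 n) (hβ n)) hDP).1 (hcen _ (hmem B hB)) n
    refine (hAn n).mul_left_cancel ((hAtn n).mul_right_cancel ?_)
    simpa only [mul_assoc] using h
  refine ⟨fun Z hZ hZc => ?_, fun B hB => ?_⟩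
  · obtain ⟨hZop, z, hz⟩ := hZ
    have hNZV : ∀ n, V (Z (Nop (Pt n))) = cm (Atn n * z n * An n) * Pt n := fun n =>
      darboux_eigenvalue hV hZop (h2 n) (h1 n) (hz n)
    have hop := hV.comp (hZop.comp hN)
    refine ⟨⟨hop, _, hNZV⟩, fun B hB => ?_⟩
    obtain ⟨β, hβ⟩ := hB.2
    refine (commute_iff_eigenvalues hPt hB.1 hop hβ hNZV).2 fun n => ?_
    have hzβ := (commute_iff_eigenvalues hP (hmem B hB).1 hZop
      (fun n => darboux_eigenvalue hN hB.1 (h1 n) (h2 n) (hβ n)) hz).1 (hZc _ (hmem B hB)) n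
    have hzD := (commute_iff_eigenvalues hP hZop (hN.comp hV) hz hDP).1
      (hcen Z ⟨hZop, z, hz⟩) n
    refine (hAtn n).mul_right_cancel ?_
    calc β n * (Atn n * z n * An n) * Atn n
        = β n * Atn n * (z n * (An n * Atn n)) := by simp only [mul_assoc]
      _ = β n * (Atn n * An n) * (Atn n * z n) := by rw [hzD]; simp only [mul_assoc]
      _ = Atn n * (An n * β n * Atn n * z n) := by
        rw [hcomm B hB β hβ]; simp only [mul_assoc]
      _ = Atn n * z n * An n * β n * Atn n := by rw [hzβ]; simp only [mul_assoc]
  · obtain ⟨β, hβ⟩ := hB.2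
    exact (commute_iff_eigenvalues hPt hB.1 (hV.comp hN) hβ hDPt).2 (hcomm B hB β hβ)
end
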